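/- Let p be an odd prime, let a be a positive integer with p ∤ a, and for m ≥ 1 set l_m := a·p·(p^{m−1} − 1). Suppose the sequence (B_{l_m}/(2 l_m))_{m ≥ 2}, viewed in ℚ_p, converges to a limit L ∈ ℚ_p. Then the p-adic norm of L equals p²; in particular L ≠ 0. -/

import Mathlib

open Filter

/-- If `p - 1` divides `2 * k` with `k` positive, then `B_{2k}` has `p`-adic norm `p`. -/
lemma padic_norm_bernoulli_two_mul (p : ℕ) [hp : Fact p.Prime] {k : ℕ} (hk : 0 < k)
    (hdvd : (p - 1) ∣ 2 * k) : ‖((bernoulli (2 * k) : ℚ) : ℚ_[p])‖ = p := by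
  obtain ⟨n, hn⟩ := Bernoulli.vonStaudt_clausen k
  have hmem : p ∈ (Finset.range (2 * k + 2)).filter fun q ↦ q.Prime ∧ (q - 1) ∣ 2 * k := by
    have := Nat.le_of_dvd (by lia) hdvd
    exact Finset.mem_filter.mpr ⟨Finset.mem_range.mpr (by lia), hp.out, hdvd⟩
  rw [← Finset.add_sum_erase _ _ hmem, ← add_assoc] at hn
  have hsum : ((bernoulli (2 * k) : ℚ) : ℚ_[p]) + (p : ℚ_[p])⁻¹ =
      (n : ℚ_[p]) - ∑ q ∈ ((Finset.range (2 * k + 2)).filter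
        fun q ↦ q.Prime ∧ (q - 1) ∣ 2 * k).erase p, (q : ℚ_[p])⁻¹ := by
    have := congrArg (fun x : ℚ ↦ (x : ℚ_[p])) hn
    push_cast at this
    simp only [one_div] at this
    exact eq_sub_of_add_eq this.symm
  have hnorm : ‖(p : ℚ_[p])⁻¹‖ = p := by rw [norm_inv, Padic.norm_p, inv_inv]
  rw [← hnorm]
  refine Padic.norm_eq_of_norm_add_lt_right ?_
  rw [hsum, hnorm, sub_eq_add_neg]
  refine lt_of_le_of_lt ?_ (Nat.one_lt_cast.mpr hp.out.one_lt)
  refine (Padic.nonarchimedean _ _).trans (max_le (Padic.norm_int_le_one n) ?_)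
  rw [norm_neg]
  refine IsUltrametricDist.norm_sum_le_of_forall_le_of_nonneg zero_le_one fun q hq ↦ ?_
  simp only [Finset.mem_erase, Finset.mem_filter] at hq
  rw [norm_inv, Padic.norm_natCast_eq_one_iff.mpr
    ((Nat.coprime_primes hp.out hq.2.2.1).mpr (Ne.symm hq.1)), inv_one]

/-- If the sequence `B_{l_m}/(2 l_m)` (for `m ≥ 2`), viewed in `ℚ_p`, converges
to `L`, then `‖L‖ = p^2`; in particular `L ≠ 0`. Here `l_m = a·p·(p^(m-1) - 1)`
with `p` an odd prime and `a` a positive integer prime to `p`. -/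
theorem norm_limit_bernoulli_div_eq_p_sq (p : ℕ) [Fact p.Prime] (hodd : Odd p)
    (a : ℕ) (ha : 0 < a) (hpa : ¬ p ∣ a)
    (l : ℕ → ℕ) (hl : ∀ m, l m = a * p * (p ^ (m - 1) - 1)) (L : ℚ_[p])
    (hconv : Tendsto
      (fun m : ℕ => ((bernoulli (l (m + 2)) / (2 * (l (m + 2) : ℚ)) : ℚ) : ℚ_[p]))
      atTop (nhds L)) :
    ‖L‖ = (p : ℝ) ^ 2 ∧ L ≠ 0 := by
  have hp : p.Prime := Fact.out
  have key (m : ℕ) :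
      ‖((bernoulli (l (m + 2)) / (2 * (l (m + 2) : ℚ)) : ℚ) : ℚ_[p])‖ = (p : ℝ) ^ 2 := by
    have hlm : l (m + 2) = a * p * (p ^ (m + 1) - 1) := hl (m + 2)
    have hlt : 1 < p ^ (m + 1) := Nat.one_lt_pow (by lia) hp.one_lt
    have hdvd : (p - 1) ∣ l (m + 2) := by
      rw [hlm]
      exact Dvd.dvd.mul_left (by simpa using Nat.sub_dvd_pow_sub_pow p 1 (m + 1)) _
    have hpos : 0 < l (m + 2) := by
      rw [hlm]
      exact Nat.mul_pos (Nat.mul_pos ha hp.pos) (by lia)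
    obtain ⟨k, hk⟩ : 2 ∣ l (m + 2) := (hodd.tsub_odd odd_one).two_dvd.trans hdvd
    have hB : ‖((bernoulli (l (m + 2)) : ℚ) : ℚ_[p])‖ = p := by
      rw [hk] at hdvd hpos ⊢
      exact padic_norm_bernoulli_two_mul p (by lia) hdvd
    have h2 : ‖(2 : ℚ_[p])‖ = 1 := by
      have : ‖((2 : ℕ) : ℚ_[p])‖ = 1 :=
        Padic.norm_natCast_eq_one_iff.mpr hodd.coprime_two_right
      exact_mod_cast this
    have hna : ‖(a : ℚ_[p])‖ = 1 :=
      Padic.norm_natCast_eq_one_iff.mpr ((Nat.Prime.coprime_iff_not_dvd hp).mpr hpa)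
    have hnp : ‖((p ^ (m + 1) - 1 : ℕ) : ℚ_[p])‖ = 1 := by
      refine Padic.norm_natCast_eq_one_iff.mpr ((Nat.Prime.coprime_iff_not_dvd hp).mpr fun h ↦ ?_)
      have := (Nat.dvd_sub_iff_right hlt.le (dvd_pow_self p m.succ_ne_zero)).mp h
      exact hp.one_lt.ne' (Nat.dvd_one.mp this)
    have hnl : ‖(l (m + 2) : ℚ_[p])‖ = (p : ℝ)⁻¹ := by
      rw [hlm, Nat.cast_mul, Nat.cast_mul, norm_mul, norm_mul, hna, hnp, Padic.norm_p]
      ring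
    push_cast
    rw [norm_div, norm_mul, hB, h2, hnl, one_mul, div_inv_eq_mul, sq]
  have hL : ‖L‖ = (p : ℝ) ^ 2 :=
    tendsto_nhds_unique hconv.norm (by simp only [key]; exact tendsto_const_nhds)
  refine ⟨hL, norm_ne_zero_iff.mp ?_⟩
  rw [hL]
  exact pow_ne_zero 2 (Nat.cast_ne_zero.mpr hp.ne_zero)
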